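/- Let α ∈ (0,1), let θ ∈ (0,1) be fixed, and let g : (0,∞) → ℝ be such that g and y ↦ y·g(y) belong to L¹(0,∞) and g has compact support; set m = ∫_0^∞ g(y) dy. Then there exists a constant C > 0 (depending on α and θ but not on g or t) such that for all t > 1, ‖w_2(·,t) − 2m·𝔈_t(·)‖_{L^{1/(1−θ)}(0,∞)} ≤ C·t^{−(1+θ)/(1+α)}·‖y g(y)‖_{L¹(0,∞)}. -/

import Mathlib

open Real MeasureTheory Set Filter Topology

noncomputable def bCoef (α : ℝ) (n : ℕ) : ℝ :=
  ∏ i ∈ Finset.range n, Real.Gamma (α * i + i + 2) / Real.Gamma (α * (i + 1) + i + 2)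

/-- The profile function `Φ(x) = ∑ bₙ (−x^{1+α}/(1+α))ⁿ`. -/
noncomputable def Phi (α : ℝ) (x : ℝ) : ℝ :=
  ∑' n : ℕ, bCoef α n * (-(x ^ (1 + α)) / (1 + α)) ^ n

/-- The Caputo fractional derivative of order `α`. -/
noncomputable def caputo (α : ℝ) (f : ℝ → ℝ) (x : ℝ) : ℝ :=
  (1 / Real.Gamma (1 - α)) * ∫ τ in (0:ℝ)..x, deriv f τ * (x - τ) ^ (-α)

/-- The normalizing constant `a₀` with `1/a₀ = 2∫₀^∞ Φ`. -/
noncomputable def a0 (α : ℝ) : ℝ := (2 * ∫ x in Set.Ioi (0:ℝ), Phi α x)⁻¹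

/-- The fundamental solution `𝔈_t(x) = a₀ t^{−1/(1+α)} Φ(|x| t^{−1/(1+α)})`. -/
noncomputable def fundSol (α t x : ℝ) : ℝ :=
  a0 α * t ^ (-1/(1+α)) * Phi α (|x| * t ^ (-1/(1+α)))

noncomputable def C1 (α : ℝ) : ℝ :=
  α * (2:ℝ) ^ (1+α) * max (∫ u in (1/2:ℝ)..1, u ^ (-(1+α)) * (1-u) ^ (α-1)) 2

noncomputable def C2 (α : ℝ) : ℝ := 2 * a0 α * C1 α


lemma aux_beta {p q x : ℝ} (hp : 0 < p) (hq : 0 < q) (hx : 0 < x) :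
    ∫ s in (0:ℝ)..x, s ^ (p-1) * (x - s) ^ (q-1) =
      Real.Gamma p * Real.Gamma q / Real.Gamma (p+q) * x ^ (p+q-1) := by
  have h := Complex.betaIntegral_scaled (p:ℂ) (q:ℂ) hx
  rw [Complex.betaIntegral_eq_Gamma_mul_div _ _ (by simpa using hp) (by simpa using hq)] at h
  have e : ∫ s in (0:ℝ)..x, ((s:ℂ) ^ ((p:ℂ)-1) * ((x:ℂ) - s) ^ ((q:ℂ)-1)) =
      ∫ s in (0:ℝ)..x, ((s ^ (p-1) * (x - s) ^ (q-1) : ℝ) : ℂ) := by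
    apply intervalIntegral.integral_congr
    intro s hs
    rw [uIcc_of_le hx.le] at hs
    simp only
    rw [Complex.ofReal_mul, Complex.ofReal_cpow hs.1, Complex.ofReal_cpow (by linarith [hs.2])]
    push_cast
    rfl
  rw [e, intervalIntegral.integral_ofReal] at h
  have : ((x:ℂ) ^ ((p:ℂ)+q-1)) = ((x ^ (p+q-1) : ℝ) : ℂ) := by
    rw [Complex.ofReal_cpow hx.le]; push_cast; rfl
  rw [this, ← Complex.ofReal_add, Complex.Gamma_ofReal, Complex.Gamma_ofReal,
    Complex.Gamma_ofReal] at h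
  rw [mul_comm]
  exact_mod_cast h

lemma aux_beta_int {p q x : ℝ} (hp : 0 < p) (hq : 0 < q) (hx : 0 < x) :
    IntervalIntegrable (fun s => s ^ (p-1) * (x - s) ^ (q-1)) volume 0 x := by
  by_contra h
  have h1 := intervalIntegral.integral_undef h
  rw [aux_beta hp hq hx] at h1
  have := Real.Gamma_pos_of_pos hp
  have := Real.Gamma_pos_of_pos hq
  have := Real.Gamma_pos_of_pos (add_pos hp hq)
  have : 0 < x ^ (p+q-1) := by positivity
  have : 0 < Real.Gamma p * Real.Gamma q / Real.Gamma (p+q) * x ^ (p+q-1) := by positivity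
  linarith

/-- maximum principle -/
lemma aux_max {α x : ℝ} (hα : 0 < α) (hx : 0 < x) {f f' : ℝ → ℝ}
    (hf : ContinuousOn f (Icc 0 x)) (hd : ∀ s ∈ Ioo 0 x, HasDerivAt f (f' s) s)
    (hi : IntervalIntegrable (fun s => f' s * (x - s) ^ (-α)) volume 0 x)
    (hi' : IntervalIntegrable f' volume 0 x)
    (hmin : ∀ s ∈ Icc 0 x, f x ≤ f s) :
    ∫ s in (0:ℝ)..x, f' s * (x - s) ^ (-α) ≤ -((f 0 - f x) * x ^ (-α)) := by
  set ε : ℕ → ℝ := fun n => 1 / ((n:ℝ) + 1) with hε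
  have hεpos : ∀ n, 0 < ε n := fun n => by simp only [hε]; positivity
  have hε0 : Tendsto ε atTop (𝓝 0) := tendsto_one_div_add_atTop_nhds_zero_nat
  have key : ∀ n, ∫ s in (0:ℝ)..x, f' s * (x + ε n - s) ^ (-α) ≤ -((f 0 - f x) * (x + ε n) ^ (-α)) := by
    intro n
    have hn := hεpos n
    have hk : ∀ s ∈ Icc 0 x, HasDerivAt (fun s => (x + ε n - s) ^ (-α)) (α * (x + ε n - s) ^ (-α - 1)) s := by
      intro s hs
      have h1 : HasDerivAt (fun s => x + ε n - s) (-1) s := by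
        simpa using (hasDerivAt_id s).const_sub (x + ε n)
      have := h1.rpow_const (p := -α) (Or.inl (by have := hs.2; linarith : x + ε n - s ≠ 0))
      convert this using 1
      ring
    have hcont : ContinuousOn (fun s => α * (x + ε n - s) ^ (-α - 1)) (Icc 0 x) := by
      apply ContinuousOn.mul continuousOn_const
      apply ContinuousOn.rpow_const (by fun_prop)
      intro s hs; left; have := hs.2; linarith
    have ibp := intervalIntegral.integral_mul_deriv_eq_deriv_mul_of_hasDeriv_right
      (a := 0) (b := x) (u := fun s => (x + ε n - s) ^ (-α)) (v := fun s => f s - f x)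
      (u' := fun s => α * (x + ε n - s) ^ (-α - 1)) (v' := f')
      (by rw [uIcc_of_le hx.le]; exact fun s hs => (hk s hs).continuousAt.continuousWithinAt)
      (by rw [uIcc_of_le hx.le]; exact hf.sub continuousOn_const)
      (by rw [min_eq_left hx.le, max_eq_right hx.le]
          exact fun s hs => (hk s ⟨hs.1.le, hs.2.le⟩).hasDerivWithinAt)
      (by rw [min_eq_left hx.le, max_eq_right hx.le]
          exact fun s hs => ((hd s hs).sub_const _).hasDerivWithinAt)
      (by apply ContinuousOn.intervalIntegrable; rwa [uIcc_of_le hx.le])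
      hi'
    have hpos : 0 ≤ ∫ s in (0:ℝ)..x, α * (x + ε n - s) ^ (-α - 1) * (f s - f x) := by
      apply intervalIntegral.integral_nonneg hx.le
      intro s hs
      have : 0 ≤ x + ε n - s := by linarith [hs.2]
      have := hmin s hs
      have : 0 ≤ f s - f x := by linarith
      positivity
    simp only [mul_comm (f' _)]
    rw [ibp]
    simp only [sub_self, mul_zero, sub_zero]
    linarith [mul_comm (f 0 - f x) ((x + ε n) ^ (-α))]
  have lim1 : Tendsto (fun n => ∫ s in (0:ℝ)..x, f' s * (x + ε n - s) ^ (-α)) atTop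
      (𝓝 (∫ s in (0:ℝ)..x, f' s * (x - s) ^ (-α))) := by
    apply intervalIntegral.tendsto_integral_filter_of_dominated_convergence
      (fun s => ‖f' s * (x - s) ^ (-α)‖)
    · refine Eventually.of_forall fun n => ?_
      refine AEStronglyMeasurable.mul ?_ ?_
      · rw [uIoc_of_le hx.le]
        exact hi'.1.aestronglyMeasurable
      · apply Measurable.aestronglyMeasurable
        fun_prop
    · refine Eventually.of_forall fun n => ?_
      have hne : ∀ᵐ s : ℝ, s ≠ x := by simp [ae_iff]
      filter_upwards [hne] with s hs hs'
      rw [uIoc_of_le hx.le] at hs'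
      have h0 : 0 < x - s := sub_pos.2 (lt_of_le_of_ne hs'.2 hs)
      have hn := hεpos n
      rw [norm_mul, norm_mul]
      gcongr ?_ * ?_
      rw [Real.norm_of_nonneg (rpow_nonneg h0.le _), Real.norm_of_nonneg (rpow_nonneg (by linarith) _)]
      exact rpow_le_rpow_of_nonpos h0 (by linarith) (by linarith)
    · exact hi.norm
    · have hne : ∀ᵐ s : ℝ, s ≠ x := by simp [ae_iff]
      filter_upwards [hne] with s hs hs'
      rw [uIoc_of_le hx.le] at hs'
      have h0 : 0 < x - s := sub_pos.2 (lt_of_le_of_ne hs'.2 hs)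
      refine Tendsto.const_mul _ ?_
      refine Tendsto.rpow_const ?_ (Or.inl h0.ne')
      have : Tendsto (fun n => x + ε n - s) atTop (𝓝 (x + 0 - s)) :=
        (hε0.const_add x).sub_const s
      simpa using this
  have lim2 : Tendsto (fun n => -((f 0 - f x) * (x + ε n) ^ (-α))) atTop
      (𝓝 (-((f 0 - f x) * x ^ (-α)))) := by
    refine (Tendsto.const_mul _ ?_).neg
    refine Tendsto.rpow_const ?_ (Or.inl hx.ne')
    simpa using hε0.const_add x
  exact le_of_tendsto_of_tendsto' lim1 lim2 key

/-- coefficients of an entire series -/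
def EntC (c : ℕ → ℝ) : Prop := ∀ R : ℝ, 0 ≤ R → Summable (fun n => |c n| * R ^ n)

/-- generalized power series -/
noncomputable def SS (r : ℝ) (c : ℕ → ℝ) (δ x : ℝ) : ℝ := ∑' n : ℕ, c n * x ^ (r * n + δ)

lemma EntC.mul_lin {c : ℕ → ℝ} (hc : EntC c) (r δ : ℝ) : EntC (fun n => c n * (r * n + δ)) := by
  intro R hR
  refine Summable.of_nonneg_of_le (fun n => by positivity) (fun n => ?_)
    ((hc (2 * R) (by positivity)).mul_left (|r| + |δ|))
  have h1 : |r * n + δ| ≤ (|r| + |δ|) * 2 ^ n := by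
    have h2 : (n:ℝ) ≤ 2 ^ n := by exact_mod_cast Nat.lt_two_pow_self.le
    have h3 : (1:ℝ) ≤ 2 ^ n := one_le_pow₀ (by norm_num)
    calc |r * n + δ| ≤ |r| * n + |δ| := by
          refine (abs_add_le _ _).trans ?_
          rw [abs_mul, Nat.abs_cast]
      _ ≤ |r| * 2 ^ n + |δ| * 2 ^ n := by
          have := abs_nonneg δ
          gcongr
          nlinarith
      _ = _ := by ring
  rw [abs_mul, mul_pow]
  calc |c n| * |r * n + δ| * R ^ n ≤ |c n| * ((|r| + |δ|) * 2 ^ n) * R ^ n := by gcongr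
    _ = _ := by ring

lemma SS_term_le {r : ℝ} (hr : 0 < r) (c : ℕ → ℝ) (δ : ℝ) {x M : ℝ} (hx : 0 < x) (hM : x ≤ M) (n : ℕ) :
    ‖c n * x ^ (r * n + δ)‖ ≤ (|c n| * (M ^ r) ^ n) * x ^ δ := by
  rw [norm_mul, Real.norm_eq_abs, Real.norm_of_nonneg (by positivity), rpow_add hx, rpow_mul hx.le,
    rpow_natCast]
  have : x ^ r ≤ M ^ r := rpow_le_rpow hx.le hM hr.le
  rw [mul_assoc]
  gcongr

lemma SS_summable {r : ℝ} (hr : 0 < r) {c : ℕ → ℝ} (hc : EntC c) (δ : ℝ) {x : ℝ} (hx : 0 < x) :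
    Summable (fun n : ℕ => c n * x ^ (r * n + δ)) :=
  Summable.of_norm_bounded ((hc (x ^ r) (by positivity)).mul_right (x ^ δ))
    (fun n => SS_term_le hr c δ hx le_rfl n)

lemma SS_bound {r : ℝ} (hr : 0 < r) {c : ℕ → ℝ} (hc : EntC c) (δ : ℝ) {M : ℝ} (hM0 : 0 < M) :
    ∃ K, 0 ≤ K ∧ ∀ x, 0 < x → x ≤ M → |SS r c δ x| ≤ K * x ^ δ := by
  refine ⟨∑' n, |c n| * (M ^ r) ^ n, tsum_nonneg fun n => by positivity, fun x hx hM => ?_⟩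
  have hs := hc (M ^ r) (by positivity)
  rw [← tsum_mul_right]
  exact tsum_of_norm_bounded (hs.mul_right (x ^ δ)).hasSum (fun n => SS_term_le hr c δ hx hM n)

lemma SS_deriv {r : ℝ} (hr : 0 < r) {c : ℕ → ℝ} (hc : EntC c) (δ : ℝ) {x : ℝ} (hx : 0 < x) :
    HasDerivAt (SS r c δ) (SS r (fun n => c n * (r * n + δ)) (δ - 1) x) x := by
  have hc' := hc.mul_lin r δ
  have hs := hc' ((2 * x) ^ r) (by positivity)
  set B := (x / 2) ^ (δ - 1) + (2 * x) ^ (δ - 1) with hB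
  have hB1 : ∀ y ∈ Ioo (x / 2) (2 * x), y ^ (δ - 1) ≤ B := by
    intro y hy
    have hy0 : 0 < y := by linarith [hy.1]
    have p1 : 0 ≤ (x / 2) ^ (δ - 1) := by positivity
    have p2 : 0 ≤ (2 * x) ^ (δ - 1) := by positivity
    rcases le_total 0 (δ - 1) with h | h
    · have := rpow_le_rpow hy0.le hy.2.le h
      linarith
    · have := rpow_le_rpow_of_nonpos (by linarith : 0 < x / 2) hy.1.le h
      linarith
  refine hasDerivAt_tsum_of_isPreconnected (t := Ioo (x / 2) (2 * x)) (hs.mul_right B) isOpen_Ioo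
    isPreconnected_Ioo (y₀ := x) (g' := fun n y => c n * (r * n + δ) * y ^ (r * n + (δ - 1))) ?_ ?_ ?_ ?_ ?_
  · intro n y hy
    have hy0 : 0 < y := by linarith [hy.1]
    have := (Real.hasDerivAt_rpow_const (p := r * n + δ) (Or.inl hy0.ne')).const_mul (c n)
    refine this.congr_deriv ?_
    rw [add_sub_assoc]; ring
  · intro n y hy
    have hy0 : 0 < y := by linarith [hy.1]
    refine (SS_term_le hr (fun n => c n * (r * n + δ)) (δ - 1) hy0 hy.2.le n).trans ?_
    gcongr
    exact hB1 y hy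
  · constructor <;> linarith
  · exact SS_summable hr hc δ hx
  · constructor <;> linarith

lemma SS_zero {r : ℝ} (hr : 0 < r) (c : ℕ → ℝ) {δ : ℝ} (hδ : 0 < δ) : SS r c δ 0 = 0 := by
  unfold SS
  have : ∀ n : ℕ, c n * (0:ℝ) ^ (r * n + δ) = 0 := fun n => by
    rw [zero_rpow (by positivity), mul_zero]
  simp [this]

lemma SS_cont {r : ℝ} (hr : 0 < r) {c : ℕ → ℝ} (hc : EntC c) {δ : ℝ} (hδ : 0 < δ) :
    ContinuousOn (SS r c δ) (Ici 0) := by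
  intro x hx
  rcases eq_or_lt_of_le (show (0:ℝ) ≤ x from hx) with h | h
  · subst h
    obtain ⟨K, hK, hb⟩ := SS_bound hr hc δ (M := 1) one_pos
    unfold ContinuousWithinAt
    rw [SS_zero hr c hδ]
    have hlim : Tendsto (fun x : ℝ => K * x ^ δ) (𝓝[Ici 0] 0) (𝓝 0) := by
      have : ContinuousAt (fun x : ℝ => K * x ^ δ) 0 :=
        (Real.continuousAt_rpow_const 0 δ (Or.inr hδ.le)).const_mul K |> fun h => h
      have h2 := this.tendsto
      simp only [zero_rpow hδ.ne', mul_zero] at h2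
      exact h2.mono_left nhdsWithin_le_nhds
    refine squeeze_zero_norm' ?_ hlim
    have : Iio (1:ℝ) ∈ 𝓝[Ici 0] (0:ℝ) := mem_nhdsWithin_of_mem_nhds (Iio_mem_nhds one_pos)
    filter_upwards [this, self_mem_nhdsWithin] with y hy hy0
    rcases eq_or_lt_of_le (show (0:ℝ) ≤ y from hy0) with h | h
    · subst h
      rw [SS_zero hr c hδ, zero_rpow hδ.ne']; simp
    · exact hb y h (le_of_lt hy)
  · exact (SS_deriv hr hc δ h).continuousAt.continuousWithinAt

lemma SS_int {r : ℝ} (hr : 0 < r) {c : ℕ → ℝ} (hc : EntC c) {δ q x : ℝ} (hδ : 0 < δ) (hq : 0 < q)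
    (hx : 0 < x) :
    IntervalIntegrable (fun s => SS r c (δ - 1) s * (x - s) ^ (q - 1)) volume 0 x := by
  obtain ⟨K, hK, hb⟩ := SS_bound hr hc (δ - 1) hx
  have h1 := (aux_beta_int hδ hq hx).const_mul K
  refine h1.mono_fun ?_ ?_
  · rw [uIoc_of_le hx.le]
    refine AEStronglyMeasurable.mul ?_ (Measurable.aestronglyMeasurable (by fun_prop))
    refine ContinuousOn.aestronglyMeasurable ?_ measurableSet_Ioc
    exact fun s hs => (SS_deriv hr hc (δ - 1) hs.1).continuousAt.continuousWithinAt
  · rw [uIoc_of_le hx.le]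
    refine (ae_restrict_iff' measurableSet_Ioc).2 (Eventually.of_forall fun s hs => ?_)
    have hs0 : 0 < s := hs.1
    have h2 : 0 ≤ (x - s) ^ (q - 1) := rpow_nonneg (by linarith [hs.2]) _
    beta_reduce
    rw [norm_mul, Real.norm_of_nonneg h2, Real.norm_of_nonneg (mul_nonneg hK (mul_nonneg (by positivity) h2)), Real.norm_eq_abs,
      ← mul_assoc]
    gcongr
    exact hb s hs.1 hs.2

lemma SS_int' {r : ℝ} (hr : 0 < r) {c : ℕ → ℝ} (hc : EntC c) {δ x : ℝ} (hδ : 0 < δ)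
    (hx : 0 < x) :
    IntervalIntegrable (SS r c (δ - 1)) volume 0 x := by
  simpa using SS_int hr hc hδ one_pos hx

lemma SS_frac {r : ℝ} (hr : 0 < r) {c : ℕ → ℝ} (hc : EntC c) {δ q x : ℝ} (hδ : 0 < δ) (hq : 0 < q)
    (hx : 0 < x) :
    ∫ s in (0:ℝ)..x, SS r c (δ - 1) s * (x - s) ^ (q - 1) =
      ∑' n : ℕ, c n * (Real.Gamma (r * n + δ) * Real.Gamma q / Real.Gamma (r * n + δ + q) *
        x ^ (r * n + δ + q - 1)) := by
  have hp : ∀ n : ℕ, 0 < r * n + δ := fun n => by positivity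
  have hint : ∀ n : ℕ, IntegrableOn (fun s => c n * (s ^ (r * n + δ - 1) * (x - s) ^ (q - 1))) (Ioc 0 x) := by
    intro n
    exact ((aux_beta_int (hp n) hq hx).const_mul (c n)).1
  have hsum : Summable fun n : ℕ => ∫ s in Ioc 0 x, ‖c n * (s ^ (r * n + δ - 1) * (x - s) ^ (q - 1))‖ := by
    refine Summable.of_nonneg_of_le (fun n => integral_nonneg fun s => norm_nonneg _) (fun n => ?_)
      ((hc (x ^ r) (by positivity)).mul_right (∫ s in Ioc 0 x, s ^ (δ - 1) * (x - s) ^ (q - 1)))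
    rw [← integral_const_mul]
    refine setIntegral_mono_on (hint n).norm ((aux_beta_int hδ hq hx).1.const_mul _) measurableSet_Ioc ?_
    intro s hs
    have h2 : 0 ≤ (x - s) ^ (q - 1) := rpow_nonneg (by linarith [hs.2]) _
    rw [← mul_assoc, norm_mul, Real.norm_of_nonneg h2, ← mul_assoc]
    gcongr
    have := SS_term_le hr c (δ - 1) hs.1 hs.2 n
    rwa [← add_sub_assoc] at this
  have h := hasSum_integral_of_summable_integral_norm (μ := volume.restrict (Ioc 0 x)) hint hsum
  rw [intervalIntegral.integral_of_le hx.le]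
  have e : ∀ s, SS r c (δ - 1) s * (x - s) ^ (q - 1) =
      ∑' n : ℕ, c n * (s ^ (r * n + δ - 1) * (x - s) ^ (q - 1)) := by
    intro s
    unfold SS
    rw [← tsum_mul_right]
    congr 1; ext n
    rw [← add_sub_assoc, mul_assoc]
  simp_rw [e]
  rw [← h.tsum_eq]
  congr 1; ext n
  rw [integral_const_mul, ← intervalIntegral.integral_of_le hx.le, aux_beta (hp n) hq hx]

lemma SS_shift {r : ℝ} (hr : 0 < r) {c : ℕ → ℝ} (hc : EntC c) (δ : ℝ) {x : ℝ} (hx : 0 < x) :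
    SS r c δ x = c 0 * x ^ δ + SS r (fun n => c (n+1)) (r + δ) x := by
  unfold SS
  rw [(SS_summable hr hc δ hx).tsum_eq_zero_add]
  congr 1
  · simp
  · congr 1; ext n; congr 2; push_cast; ring

lemma SS_mul_self {r : ℝ} (c : ℕ → ℝ) (δ : ℝ) {x : ℝ} (hx : 0 < x) :
    x * SS r c δ x = SS r c (δ + 1) x := by
  unfold SS
  rw [← tsum_mul_left]
  congr 1; ext n
  rw [← add_assoc, rpow_add hx _ 1, rpow_one]; ring

lemma bCoef_pos {α : ℝ} (hα : 0 < α) (n : ℕ) : 0 < bCoef α n := by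
  unfold bCoef
  apply Finset.prod_pos
  intro i _
  exact div_pos (Real.Gamma_pos_of_pos (by positivity)) (Real.Gamma_pos_of_pos (by positivity))

lemma bCoef_succ (α : ℝ) (n : ℕ) : bCoef α (n+1) =
    bCoef α n * (Real.Gamma ((1+α) * n + 2) / Real.Gamma ((1+α) * n + 2 + α)) := by
  unfold bCoef
  rw [Finset.prod_range_succ]
  congr 3 <;> ring

lemma gamma_ratio {α x : ℝ} (h0 : 0 < α) (h1 : α < 1) (hx : 1 ≤ x) :
    Real.Gamma x / Real.Gamma (x + α) ≤ 2 * x ^ (-α) := by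
  have hx0 : 0 < x := by linarith
  have hG := Real.Gamma_pos_of_pos (add_pos hx0 h0)
  have hG' := Real.Gamma_pos_of_pos hx0
  have h := Real.Gamma_mul_add_mul_le_rpow_Gamma_mul_rpow_Gamma (s := x + α) (t := x + α + 1)
    (a := α) (b := 1 - α) (by positivity) (by positivity) h0 (by linarith) (by ring)
  have e : α * (x + α) + (1 - α) * (x + α + 1) = x + 1 := by ring
  rw [e, Real.Gamma_add_one hx0.ne', Real.Gamma_add_one (by positivity),
    mul_rpow (by positivity) hG.le, mul_comm ((x + α) ^ (1 - α)), ← mul_assoc, ← rpow_add hG,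
    add_sub_cancel, rpow_one] at h
  have h3 : (x + α) ^ (1 - α) ≤ 2 * x ^ (1 - α) := by
    calc (x + α) ^ (1 - α) ≤ (2 * x) ^ (1 - α) := by
          apply rpow_le_rpow <;> linarith
      _ = 2 ^ (1 - α) * x ^ (1 - α) := mul_rpow (by norm_num) hx0.le
      _ ≤ 2 ^ (1:ℝ) * x ^ (1 - α) := by
          gcongr
          · norm_num
          · linarith
      _ = _ := by rw [rpow_one]
  have h4 : x ^ (1 - α) = x * x ^ (-α) := by
    rw [sub_eq_add_neg, rpow_add hx0, rpow_one]
  rw [div_le_iff₀ hG]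
  have h5 : x * Real.Gamma x ≤ x * (2 * x ^ (-α) * Real.Gamma (x + α)) := by
    calc x * Real.Gamma x ≤ Real.Gamma (x + α) * (x + α) ^ (1 - α) := h
      _ ≤ Real.Gamma (x + α) * (2 * x ^ (1 - α)) := by gcongr
      _ = _ := by rw [h4]; ring
  exact le_of_mul_le_mul_left h5 hx0

/-- signed coefficients -/
noncomputable def eC (α : ℝ) (n : ℕ) : ℝ := bCoef α n * (-1 / (1 + α)) ^ n

lemma eC_ent {α : ℝ} (h0 : 0 < α) (h1 : α < 1) : EntC (eC α) := by
  intro R hR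
  rcases hR.eq_or_lt with rfl | hR
  · refine summable_of_ne_finset_zero (s := {0}) fun n hn => ?_
    simp at hn
    simp [hn]
  have hpos : ∀ n, 0 < |eC α n| * R ^ n := by
    intro n
    have := (bCoef_pos h0 n).ne'
    have : eC α n ≠ 0 := by
      unfold eC
      refine mul_ne_zero this (pow_ne_zero _ (div_ne_zero (by norm_num) (by positivity)))
    positivity
  have hlim : Tendsto (fun n : ℕ => 2 * ((1+α) * n + 2) ^ (-α) * (R / (1+α))) atTop (𝓝 0) := by
    have t1 : Tendsto (fun n : ℕ => (1+α) * (n:ℝ) + 2) atTop atTop :=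
      tendsto_atTop_add_const_right _ _ (tendsto_natCast_atTop_atTop.const_mul_atTop (by positivity))
    have := (((tendsto_rpow_neg_atTop h0).comp t1).const_mul 2).mul_const (R / (1+α))
    simpa using this
  refine summable_of_ratio_test_tendsto_lt_one (l := 0) one_pos
    (Eventually.of_forall fun n => (hpos n).ne') ?_
  refine squeeze_zero (fun n => by positivity) (fun n => ?_) hlim
  rw [Real.norm_of_nonneg (hpos _).le, Real.norm_of_nonneg (hpos _).le, div_le_iff₀ (hpos n)]
  have hb := bCoef_pos h0 n
  have hr : 0 ≤ (Real.Gamma ((1+α) * n + 2) / Real.Gamma ((1+α) * n + 2 + α)) :=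
    (div_pos (Real.Gamma_pos_of_pos (by positivity)) (Real.Gamma_pos_of_pos (by positivity))).le
  have hg := gamma_ratio (x := (1+α) * n + 2) h0 h1 (by nlinarith [Nat.cast_nonneg (α := ℝ) n])
  unfold eC
  rw [bCoef_succ, abs_mul, abs_mul, abs_mul, abs_pow, abs_pow, abs_of_pos hb, abs_of_nonneg hr,
    abs_div, abs_neg, abs_one, abs_of_pos (by positivity : 0 < 1 + α)]
  calc _ = (Real.Gamma ((1+α) * n + 2) / Real.Gamma ((1+α) * n + 2 + α)) * (R / (1+α)) *
        (bCoef α n * (1 / (1 + α)) ^ n * R ^ n) := by rw [pow_succ, pow_succ]; ring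
    _ ≤ _ := by gcongr

/-- coefficients of the first derivative -/
noncomputable def dC (α : ℝ) (n : ℕ) : ℝ := eC α (n+1) * ((1+α) * n + (1+α))

lemma EntC.shift {c : ℕ → ℝ} (hc : EntC c) : EntC (fun n => c (n+1)) := by
  intro R hR
  have h := (summable_nat_add_iff 1).2 (hc (R + 1) (by positivity))
  refine Summable.of_nonneg_of_le (fun n => by positivity) (fun n => ?_) h
  gcongr
  calc R ^ n ≤ (R+1) ^ n := by gcongr; linarith
    _ ≤ (R+1) ^ (n+1) := pow_le_pow_right₀ (by linarith) (by omega)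

lemma dC_ent {α : ℝ} (h0 : 0 < α) (h1 : α < 1) : EntC (dC α) :=
  (eC_ent h0 h1).shift.mul_lin _ _

lemma Phi_eq {α : ℝ} {x : ℝ} (hx : 0 ≤ x) : Phi α x = SS (1+α) (eC α) 0 x := by
  unfold Phi SS eC
  congr 1; ext n
  rw [add_zero, rpow_mul hx, rpow_natCast, mul_assoc, ← mul_pow]
  congr 2; ring

lemma Phi_zero {α : ℝ} (h0 : 0 < α) : Phi α 0 = 1 := by
  unfold Phi
  rw [tsum_eq_single 0]
  · simp [bCoef]
  · intro n hn
    rw [zero_rpow (by positivity)]; simp [hn]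

lemma eC_zero (α : ℝ) : eC α 0 = 1 := by simp [eC, bCoef]

lemma Phi_eq' {α : ℝ} (h0 : 0 < α) (h1 : α < 1) {x : ℝ} (hx : 0 ≤ x) :
    Phi α x = 1 + SS (1+α) (fun n => eC α (n+1)) (1+α) x := by
  rcases hx.eq_or_lt with rfl | hx
  · rw [Phi_zero h0, SS_zero (by positivity) _ (by positivity), add_zero]
  · rw [Phi_eq hx.le, SS_shift (by positivity) (eC_ent h0 h1) 0 hx, eC_zero]
    simp

lemma Phi_cont {α : ℝ} (h0 : 0 < α) (h1 : α < 1) : ContinuousOn (Phi α) (Ici 0) := by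
  have := (SS_cont (r := 1+α) (by positivity) (eC_ent h0 h1).shift (δ := 1+α) (by positivity)).const_add 1
  exact this.congr fun x hx => Phi_eq' h0 h1 hx

/-- derivative of the profile -/
noncomputable def dPhi (α x : ℝ) : ℝ := SS (1+α) (dC α) α x

/-- second derivative of the profile -/
noncomputable def ddPhi (α x : ℝ) : ℝ := SS (1+α) (fun n => dC α n * ((1+α) * n + α)) (α - 1) x

lemma Phi_deriv {α : ℝ} (h0 : 0 < α) (h1 : α < 1) {x : ℝ} (hx : 0 < x) :
    HasDerivAt (Phi α) (dPhi α x) x := by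
  have h := (SS_deriv (r := 1+α) (by positivity) (eC_ent h0 h1).shift (1+α) hx).const_add 1
  have e : SS (1+α) (fun n => eC α (n+1) * ((1+α) * n + (1+α))) (1 + α - 1) x = dPhi α x := by
    unfold dPhi dC
    rw [add_sub_cancel_left]
  rw [e] at h
  refine h.congr_of_eventuallyEq ?_
  filter_upwards [Ioi_mem_nhds hx] with y hy
  exact Phi_eq' h0 h1 (le_of_lt hy)

lemma dPhi_deriv {α : ℝ} (h0 : 0 < α) (h1 : α < 1) {x : ℝ} (hx : 0 < x) :
    HasDerivAt (dPhi α) (ddPhi α x) x :=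
  SS_deriv (by positivity) (dC_ent h0 h1) α hx

lemma dPhi_cont {α : ℝ} (h0 : 0 < α) (h1 : α < 1) : ContinuousOn (dPhi α) (Ici 0) :=
  SS_cont (by positivity) (dC_ent h0 h1) h0

lemma dPhi_zero {α : ℝ} (h0 : 0 < α) : dPhi α 0 = 0 := SS_zero (by positivity) _ h0

lemma dPhi_int {α : ℝ} (h0 : 0 < α) (h1 : α < 1) {x : ℝ} (hx : 0 < x) :
    IntervalIntegrable (fun s => dPhi α s * (x - s) ^ (-α)) volume 0 x := by
  have := SS_int (r := 1+α) (by positivity) (dC_ent h0 h1) (δ := 1+α) (q := 1-α) (by positivity)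
    (by linarith) hx
  simpa [dPhi] using this

lemma dPhi_int' {α : ℝ} (h0 : 0 < α) (h1 : α < 1) {x : ℝ} (hx : 0 < x) :
    IntervalIntegrable (dPhi α) volume 0 x := by
  have := SS_int' (r := 1+α) (by positivity) (dC_ent h0 h1) (δ := 1+α) (by positivity) hx
  rw [add_sub_cancel_left] at this
  exact this

lemma ddPhi_int {α : ℝ} (h0 : 0 < α) (h1 : α < 1) {x : ℝ} (hx : 0 < x) :
    IntervalIntegrable (fun s => ddPhi α s * (x - s) ^ (-α)) volume 0 x := by
  have := SS_int (r := 1+α) (by positivity) ((dC_ent h0 h1).mul_lin (1+α) α) (δ := α) (q := 1-α) h0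
    (by linarith) hx
  simpa [ddPhi] using this

lemma ddPhi_int' {α : ℝ} (h0 : 0 < α) (h1 : α < 1) {x : ℝ} (hx : 0 < x) :
    IntervalIntegrable (ddPhi α) volume 0 x :=
  SS_int' (r := 1+α) (by positivity) ((dC_ent h0 h1).mul_lin (1+α) α) (δ := α) h0 hx

lemma eC_succ (α : ℝ) (n : ℕ) : eC α (n+1) =
    eC α n * (Real.Gamma ((1+α) * n + 2) / Real.Gamma ((1+α) * n + 2 + α)) * (-1 / (1+α)) := by
  unfold eC
  rw [bCoef_succ, pow_succ]; ring

lemma frac1 {α : ℝ} (h0 : 0 < α) (h1 : α < 1) {x : ℝ} (hx : 0 < x) :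
    ∫ s in (0:ℝ)..x, dPhi α s * (x - s) ^ (-α) =
      -(Real.Gamma (1-α) / (1+α)) * (x * Phi α x) := by
  have h := SS_frac (r := 1+α) (by positivity) (dC_ent h0 h1) (δ := 1+α) (q := 1-α) (by positivity)
    (by linarith) hx
  have e : (fun s => SS (1+α) (dC α) (1 + α - 1) s * (x - s) ^ (1 - α - 1)) =
      fun s => dPhi α s * (x - s) ^ (-α) := by
    ext s; unfold dPhi; congr 2 <;> ring
  rw [e] at h
  rw [h, Phi_eq hx.le, SS_mul_self _ _ hx]
  unfold SS
  rw [← tsum_mul_left]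
  congr 1; ext n
  have hp : 0 < (1+α) * n + (1+α) := by positivity
  have hg1 := (Real.Gamma_pos_of_pos (show 0 < (1+α) * (n:ℝ) + 2 by positivity)).ne'
  have hg2 := (Real.Gamma_pos_of_pos hp).ne'
  have e1 : (1+α) * n + 2 + α = ((1+α) * n + (1+α)) + 1 := by ring
  have e2 : (1+α) * n + (1+α) + (1 - α) = (1+α) * n + 2 := by ring
  have e3 : (1+α) * n + 2 - 1 = (1+α) * n + (0 + 1) := by ring
  unfold dC
  rw [eC_succ, e1, Real.Gamma_add_one hp.ne', e2, e3]
  field_simp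

lemma frac2 {α : ℝ} (h0 : 0 < α) (h1 : α < 1) {x : ℝ} (hx : 0 < x) :
    ∫ s in (0:ℝ)..x, ddPhi α s * (x - s) ^ (-α) =
      -(Real.Gamma (1-α) / (1+α)) * (Phi α x + x * dPhi α x) := by
  have hr : 0 < 1 + α := by positivity
  have hE := eC_ent h0 h1
  have h := SS_frac (r := 1+α) (by positivity) ((dC_ent h0 h1).mul_lin (1+α) α) (δ := α) (q := 1-α) h0
    (by linarith) hx
  have e : (fun s => SS (1+α) (fun n => dC α n * ((1+α) * n + α)) (α - 1) s * (x - s) ^ (1 - α - 1)) =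
      fun s => ddPhi α s * (x - s) ^ (-α) := by
    ext s; unfold ddPhi; congr 2; ring
  rw [e] at h
  have hS := SS_shift hr (hE.mul_lin (1+α) 0) 0 hx
  have hd : x * dPhi α x = SS (1+α) (fun n => eC α n * ((1+α) * n + 0)) 0 x := by
    unfold dPhi
    rw [SS_mul_self _ _ hx, hS]
    simp only [CharP.cast_eq_zero, mul_zero, add_zero, zero_mul, zero_add]
    unfold dC
    congr 1
    · ext n; push_cast; ring
    · ring
  rw [h, hd, Phi_eq hx.le]
  unfold SS
  rw [← (SS_summable hr hE 0 hx).tsum_add (SS_summable hr (hE.mul_lin (1+α) 0) 0 hx),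
    ← tsum_mul_left]
  congr 1; ext n
  have hp : 0 < (1+α) * n + α := by positivity
  have hp1 : 0 < (1+α) * (n:ℝ) + 1 := by positivity
  have hg1 := (Real.Gamma_pos_of_pos hp1).ne'
  have hg2 := (Real.Gamma_pos_of_pos hp).ne'
  have e1 : (1+α) * n + 2 + α = ((1+α) * n + α) + 1 + 1 := by ring
  have e2 : (1+α) * n + α + (1 - α) = (1+α) * n + 1 := by ring
  have e3 : (1+α) * n + 1 - 1 = (1+α) * n + 0 := by ring
  have e4 : (1+α) * (n:ℝ) + 2 = (1+α) * n + 1 + 1 := by ring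
  unfold dC
  rw [eC_succ, e1, Real.Gamma_add_one (by positivity), Real.Gamma_add_one hp.ne', e2, e3, e4,
    Real.Gamma_add_one hp1.ne']
  have : (1+α) * (n:ℝ) + α + 1 ≠ 0 := by positivity
  field_simp
  ring

lemma Phi_nonneg {α : ℝ} (h0 : 0 < α) (h1 : α < 1) {x : ℝ} (hx : 0 ≤ x) : 0 ≤ Phi α x := by
  by_contra! hneg
  have hc : ContinuousOn (Phi α) (Icc 0 x) := (Phi_cont h0 h1).mono Icc_subset_Ici_self
  obtain ⟨z, hz, hmin⟩ := isCompact_Icc.exists_isMinOn (nonempty_Icc.2 hx) hc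
  have hz' : Phi α z < 0 := (hmin (right_mem_Icc.2 hx)).trans_lt hneg
  have hz0 : 0 < z := by
    rcases hz.1.eq_or_lt with h | h
    · rw [← h, Phi_zero h0] at hz'; linarith
    · exact h
  have h := aux_max (f := Phi α) (f' := dPhi α) h0 hz0 (hc.mono (Icc_subset_Icc_right hz.2))
    (fun s hs => Phi_deriv h0 h1 hs.1) (dPhi_int h0 h1 hz0) (dPhi_int' h0 h1 hz0)
    (fun s hs => hmin ⟨hs.1, hs.2.trans hz.2⟩)
  rw [frac1 h0 h1 hz0, Phi_zero h0] at h
  have hG := Real.Gamma_pos_of_pos (show 0 < 1 - α by linarith)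
  have p1 : 0 < (1 - Phi α z) * z ^ (-α) := mul_pos (by linarith) (by positivity)
  have p2 : 0 < (Real.Gamma (1-α) / (1+α)) * (z * (-Phi α z)) := by
    have : 0 < -Phi α z := by linarith
    positivity
  linarith

lemma dPhi_nonpos {α : ℝ} (h0 : 0 < α) (h1 : α < 1) {x : ℝ} (hx : 0 ≤ x) : dPhi α x ≤ 0 := by
  by_contra! hneg
  have hc : ContinuousOn (dPhi α) (Icc 0 x) := (dPhi_cont h0 h1).mono Icc_subset_Ici_self
  obtain ⟨z, hz, hmax⟩ := isCompact_Icc.exists_isMaxOn (nonempty_Icc.2 hx) hc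
  have hz' : 0 < dPhi α z := hneg.trans_le (hmax (right_mem_Icc.2 hx))
  have hz0 : 0 < z := by
    rcases hz.1.eq_or_lt with h | h
    · rw [← h, dPhi_zero h0] at hz'; linarith
    · exact h
  have h := aux_max (f := fun s => -dPhi α s) (f' := fun s => -ddPhi α s) h0 hz0
    (hc.mono (Icc_subset_Icc_right hz.2)).neg
    (fun s hs => (dPhi_deriv h0 h1 hs.1).neg) (by simp only [neg_mul]; exact (ddPhi_int h0 h1 hz0).neg)
    (ddPhi_int' h0 h1 hz0).neg
    (fun s hs => neg_le_neg (hmax ⟨hs.1, hs.2.trans hz.2⟩))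
  simp only [neg_mul, intervalIntegral.integral_neg] at h
  rw [frac2 h0 h1 hz0, dPhi_zero h0] at h
  have hG := Real.Gamma_pos_of_pos (show 0 < 1 - α by linarith)
  have hP := Phi_nonneg h0 h1 hz0.le
  have p1 : 0 < dPhi α z * z ^ (-α) := by positivity
  have p2 : 0 < (Real.Gamma (1-α) / (1+α)) * (Phi α z + z * dPhi α z) := by positivity
  linarith

lemma Phi_anti {α : ℝ} (h0 : 0 < α) (h1 : α < 1) : AntitoneOn (Phi α) (Ici 0) := by
  refine antitoneOn_of_deriv_nonpos (convex_Ici 0) (Phi_cont h0 h1) ?_ ?_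
  · rw [interior_Ici]
    exact fun x hx => (Phi_deriv h0 h1 hx).differentiableAt.differentiableWithinAt
  · rw [interior_Ici]
    intro x hx
    rw [(Phi_deriv h0 h1 hx).deriv]
    exact dPhi_nonpos h0 h1 (le_of_lt hx)

lemma Phi_le_one {α : ℝ} (h0 : 0 < α) (h1 : α < 1) {x : ℝ} (hx : 0 ≤ x) : Phi α x ≤ 1 := by
  rw [← Phi_zero h0]
  exact Phi_anti h0 h1 (mem_Ici.2 le_rfl) hx hx

lemma dPhi_bdd {α : ℝ} (h0 : 0 < α) (h1 : α < 1) : ∃ L, 0 < L ∧ ∀ x, 0 ≤ x → -L ≤ dPhi α x := by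
  have hc1 : ContinuousOn (dPhi α) (Icc 0 1) := (dPhi_cont h0 h1).mono Icc_subset_Ici_self
  obtain ⟨K, hK⟩ := isCompact_Icc.exists_bound_of_continuousOn hc1
  refine ⟨max K 1, lt_max_of_lt_right one_pos, fun x hx => ?_⟩
  have hc : ContinuousOn (dPhi α) (Icc 0 x) := (dPhi_cont h0 h1).mono Icc_subset_Ici_self
  obtain ⟨z, hz, hmin⟩ := isCompact_Icc.exists_isMinOn (nonempty_Icc.2 hx) hc
  refine le_trans ?_ (hmin (right_mem_Icc.2 hx))
  rcases le_or_gt z 1 with hz1 | hz1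
  · have := (abs_le.1 (hK z ⟨hz.1, hz1⟩)).1
    have := le_max_left K 1
    linarith
  have hz0 : 0 < z := by linarith
  have h := aux_max (f := dPhi α) (f' := ddPhi α) h0 hz0
    (hc.mono (Icc_subset_Icc_right hz.2))
    (fun s hs => dPhi_deriv h0 h1 hs.1) (ddPhi_int h0 h1 hz0)
    (ddPhi_int' h0 h1 hz0)
    (fun s hs => hmin ⟨hs.1, hs.2.trans hz.2⟩)
  rw [frac2 h0 h1 hz0, dPhi_zero h0] at h
  have hG := Real.Gamma_pos_of_pos (show 0 < 1 - α by linarith)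
  have hd := dPhi_nonpos h0 h1 hz0.le
  have p1 : 0 ≤ (0 - dPhi α z) * z ^ (-α) := mul_nonneg (by linarith) (by positivity)
  have p2 : 0 ≤ (Real.Gamma (1-α) / (1+α)) * (Phi α z + z * dPhi α z) := by linarith
  have p3 : 0 ≤ Phi α z + z * dPhi α z := nonneg_of_mul_nonneg_right p2 (by positivity)
  have := Phi_le_one h0 h1 hz0.le
  have := le_max_right K 1
  nlinarith

lemma Phi_lip {α : ℝ} (h0 : 0 < α) (h1 : α < 1) : ∃ L, 0 < L ∧ ∀ x y, 0 ≤ x → 0 ≤ y →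
    |Phi α x - Phi α y| ≤ L * |x - y| := by
  obtain ⟨L, hL, hb⟩ := dPhi_bdd h0 h1
  refine ⟨L, hL, ?_⟩
  have key : ∀ x y, 0 ≤ x → x ≤ y → |Phi α x - Phi α y| ≤ L * |x - y| := by
    intro x y hx hxy
    have ha := Phi_anti h0 h1 (show x ∈ Ici (0:ℝ) from hx) (show y ∈ Ici (0:ℝ) from hx.trans hxy) hxy
    rw [abs_of_nonneg (by linarith), abs_of_nonpos (by linarith)]
    have := (convex_Ici (0:ℝ)).mul_sub_le_image_sub_of_le_deriv (f := Phi α) (C := -L) (Phi_cont h0 h1)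
      (by rw [interior_Ici]
          exact fun x hx => (Phi_deriv h0 h1 hx).differentiableAt.differentiableWithinAt)
      (by rw [interior_Ici]
          intro x hx
          rw [(Phi_deriv h0 h1 hx).deriv]
          exact hb x (le_of_lt hx)) x hx y (hx.trans hxy) hxy
    linarith
  intro x y hx hy
  rcases le_total x y with h | h
  · exact key x y hx h
  · rw [abs_sub_comm, abs_sub_comm x]; exact key y x hy h

lemma shift_right {Ψ : ℝ → ℝ} (hc : Continuous Ψ) (hn : ∀ x, 0 ≤ Ψ x) (h1 : ∀ x, Ψ x ≤ 1)
    (ha : AntitoneOn Ψ (Ici 0)) {y : ℝ} (hy : 0 < y) :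
    ∫⁻ x in Ioi (0:ℝ), ‖Ψ (x + y) - Ψ x‖ₑ ≤ ENNReal.ofReal y := by
  have hcI : ∀ a b, IntervalIntegrable Ψ volume a b := fun a b => hc.intervalIntegrable a b
  have hcy : Continuous fun x => Ψ (x + y) := hc.comp (by fun_prop)
  have hbd : ∀ R : ℝ, 0 ≤ R → ∫ x in (0:ℝ)..R, ‖Ψ (x + y) - Ψ x‖ ≤ y := by
    intro R hR
    have e : ∫ x in (0:ℝ)..R, ‖Ψ (x + y) - Ψ x‖ = ∫ x in (0:ℝ)..R, (Ψ x - Ψ (x + y)) := by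
      apply intervalIntegral.integral_congr
      intro x hx
      rw [uIcc_of_le hR] at hx
      have := ha (show x ∈ Ici (0:ℝ) from hx.1) (show x + y ∈ Ici (0:ℝ) from by
        have := hx.1; simp only [mem_Ici]; linarith) (by linarith : x ≤ x + y)
      simp only
      rw [norm_sub_rev, Real.norm_of_nonneg (by linarith)]
    rw [e, intervalIntegral.integral_sub (hcI _ _) (hcy.intervalIntegrable _ _),
      intervalIntegral.integral_comp_add_right (fun x => Ψ x), zero_add]
    have e1 := intervalIntegral.integral_add_adjacent_intervals (hcI 0 y) (hcI y (R + y))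
    have e2 := intervalIntegral.integral_add_adjacent_intervals (hcI 0 R) (hcI R (R + y))
    have p1 : 0 ≤ ∫ x in R..(R+y), Ψ x :=
      intervalIntegral.integral_nonneg (by linarith) (fun x _ => hn x)
    have p2 : ∫ x in (0:ℝ)..y, Ψ x ≤ ∫ x in (0:ℝ)..y, (1:ℝ) :=
      intervalIntegral.integral_mono_on hy.le (hcI _ _) (by simp) (fun x _ => h1 x)
    simp at p2
    linarith
  have hcd : Continuous fun x => Ψ (x + y) - Ψ x := hcy.sub hc
  have hI : IntegrableOn (fun x => Ψ (x + y) - Ψ x) (Ioi 0) := by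
    refine integrableOn_Ioi_of_intervalIntegral_norm_bounded y 0 (l := atTop) (b := fun R : ℝ => R) ?_ tendsto_id ?_
    · intro R
      exact (hcd.intervalIntegrable 0 R).1
    · filter_upwards [eventually_ge_atTop 0] with R hR using hbd R hR
  rw [← ofReal_integral_norm_eq_lintegral_enorm hI]
  apply ENNReal.ofReal_le_ofReal
  refine le_of_tendsto (intervalIntegral_tendsto_integral_Ioi 0 hI.norm tendsto_id) ?_
  filter_upwards [eventually_ge_atTop 0] with R hR using hbd R hR

lemma shift_left {Ψ : ℝ → ℝ} (hc : Continuous Ψ) (hn : ∀ x, 0 ≤ Ψ x) (h1 : ∀ x, Ψ x ≤ 1)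
    (ha : AntitoneOn Ψ (Ici 0)) {y : ℝ} (hy : 0 < y) :
    ∫⁻ x in Ioi (0:ℝ), ‖Ψ (x - y) - Ψ x‖ₑ ≤ 2 * ENNReal.ofReal y := by
  have hU : Ioi (0:ℝ) = Ioc 0 y ∪ Ioi y := (Ioc_union_Ioi_eq_Ioi hy.le).symm
  rw [hU]
  refine (lintegral_union_le _ _ _).trans ?_
  rw [two_mul]
  refine add_le_add ?_ ?_
  · calc ∫⁻ x in Ioc 0 y, ‖Ψ (x - y) - Ψ x‖ₑ ≤ ∫⁻ x in Ioc 0 y, 1 := by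
          apply lintegral_mono
          intro x
          beta_reduce
          rw [← ofReal_norm, ← ENNReal.ofReal_one]
          apply ENNReal.ofReal_le_ofReal
          rw [Real.norm_eq_abs, abs_le]
          constructor <;> linarith [hn x, hn (x - y), h1 x, h1 (x - y)]
      _ = ENNReal.ofReal y := by simp
  · have hmp := (measurePreserving_add_right (volume : Measure ℝ) y).setLIntegral_comp_preimage_emb
      (measurableEmbedding_addRight y) (fun x => ‖Ψ (x - y) - Ψ x‖ₑ) (Ioi y)
    rw [← hmp]
    have : (fun x => x + y) ⁻¹' (Ioi y) = Ioi 0 := by ext x; simp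
    rw [this]
    simp only [add_sub_cancel_right]
    simp_rw [← enorm_neg (Ψ _ - Ψ (_ + y)), neg_sub]
    exact shift_right hc hn h1 ha hy

lemma interp {F : ℝ → ℝ} {θ : ℝ} (hθ : θ ∈ Ioo (0:ℝ) 1) {μ : Measure ℝ} {A B : ENNReal} (hA : A ≠ ⊤)
    (h1 : ∀ᵐ x ∂μ, ‖F x‖ₑ ≤ A) (h2 : ∫⁻ x, ‖F x‖ₑ ∂μ ≤ B) :
    eLpNorm F (ENNReal.ofReal (1/(1-θ))) μ ≤ A ^ θ * B ^ (1 - θ) := by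
  have hθ1 : 0 < 1 - θ := by linarith [hθ.2]
  have hp : 0 < 1/(1-θ) := by positivity
  have hp1 : 0 ≤ 1/(1-θ) - 1 := by
    rw [sub_nonneg, le_div_iff₀ hθ1]; linarith [hθ.1]
  rw [eLpNorm_eq_lintegral_rpow_enorm_toReal (by simpa using hp) ENNReal.ofReal_ne_top,
    ENNReal.toReal_ofReal hp.le]
  have key : ∫⁻ x, ‖F x‖ₑ ^ (1/(1-θ)) ∂μ ≤ A ^ (1/(1-θ) - 1) * B := by
    calc ∫⁻ x, ‖F x‖ₑ ^ (1/(1-θ)) ∂μ ≤ ∫⁻ x, A ^ (1/(1-θ) - 1) * ‖F x‖ₑ ∂μ := by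
          apply lintegral_mono_ae
          filter_upwards [h1] with x hx
          calc ‖F x‖ₑ ^ (1/(1-θ)) = ‖F x‖ₑ ^ ((1/(1-θ) - 1) + 1) := by congr 1; ring
            _ = ‖F x‖ₑ ^ (1/(1-θ) - 1) * ‖F x‖ₑ := by
              rw [ENNReal.rpow_add_of_nonneg _ _ hp1 zero_le_one, ENNReal.rpow_one]
            _ ≤ _ := by gcongr
      _ = A ^ (1/(1-θ) - 1) * ∫⁻ x, ‖F x‖ₑ ∂μ := by
          rw [lintegral_const_mul' _ _ (ENNReal.rpow_ne_top_of_nonneg hp1 hA)]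
      _ ≤ _ := by gcongr
  calc _ ≤ (A ^ (1/(1-θ) - 1) * B) ^ (1 / (1/(1-θ))) := by gcongr
    _ = _ := by
      rw [ENNReal.mul_rpow_of_nonneg _ _ (by positivity), ← ENNReal.rpow_mul]
      congr 2
      · field_simp; ring
      · field_simp

/-- Convergence of the solution `w₂` of the Neumann problem to `2m·𝔈_t` in `L^{1/(1−θ)}(0,∞)`. -/
theorem stmt14 (α θ : ℝ) (hα : α ∈ Set.Ioo (0:ℝ) 1) (hθ : θ ∈ Set.Ioo (0:ℝ) 1) :
    ∃ C > (0:ℝ), ∀ g : ℝ → ℝ, IntegrableOn g (Set.Ioi 0) →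
      IntegrableOn (fun y => y * g y) (Set.Ioi 0) → HasCompactSupport g →
      ∀ t > (1:ℝ),
        eLpNorm (fun x => (∫ y in Set.Ioi (0:ℝ),
            (fundSol α t (x - y) + fundSol α t (x + y)) * g y) -
            2 * (∫ y in Set.Ioi (0:ℝ), g y) * fundSol α t x)
          (ENNReal.ofReal (1/(1-θ))) (volume.restrict (Set.Ioi 0)) ≤
        ENNReal.ofReal (C * t ^ (-(1+θ)/(1+α)) * ∫ y in Set.Ioi (0:ℝ), |y * g y|) := by
  have h0 := hα.1
  have h1 := hα.2
  obtain ⟨L, hL, hlip⟩ := Phi_lip h0 h1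
  refine ⟨|a0 α| * ((2 * L) ^ θ * 3 ^ (1 - θ)) + 1, by positivity, ?_⟩
  intro g hg hyg _ t ht
  have ht0 : 0 < t := by linarith
  set τ := t ^ (-1/(1+α)) with hτdef
  have hτ : 0 < τ := by positivity
  set Ψ : ℝ → ℝ := fun x => Phi α (|x| * τ) with hΨ
  have hmem : ∀ x : ℝ, 0 ≤ |x| * τ := fun x => by positivity
  have hc : Continuous Ψ := (Phi_cont h0 h1).comp_continuous (by fun_prop) hmem
  have hn : ∀ x, 0 ≤ Ψ x := fun x => Phi_nonneg h0 h1 (hmem x)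
  have hle : ∀ x, Ψ x ≤ 1 := fun x => Phi_le_one h0 h1 (hmem x)
  have ha : AntitoneOn Ψ (Ici 0) := by
    intro x hx y hy hxy
    refine Phi_anti h0 h1 (hmem x) (hmem y) ?_
    rw [abs_of_nonneg hx, abs_of_nonneg hy]
    gcongr
  have hL' : ∀ x y, |Ψ x - Ψ y| ≤ L * τ * |x - y| := by
    intro x y
    refine (hlip _ _ (hmem x) (hmem y)).trans ?_
    rw [← sub_mul, abs_mul, abs_of_pos hτ, mul_assoc, mul_comm τ]
    exact mul_le_mul_of_nonneg_left (mul_le_mul_of_nonneg_right (abs_abs_sub_abs_le x y) hτ.le) hL.le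
  set m := ∫ y in Ioi (0:ℝ), |y * g y| with hm
  have hm0 : 0 ≤ m := integral_nonneg fun y => abs_nonneg _
  have hM : ∫⁻ y in Ioi (0:ℝ), ‖y * g y‖ₑ = ENNReal.ofReal m :=
    (ofReal_integral_norm_eq_lintegral_enorm hyg).symm
  set c := a0 α * τ with hcdef
  set k : ℝ → ℝ → ℝ := fun x y => Ψ (x - y) + Ψ (x + y) - 2 * Ψ x with hk
  set F : ℝ → ℝ := fun x => (∫ y in Ioi (0:ℝ),
            (fundSol α t (x - y) + fundSol α t (x + y)) * g y) -
            2 * (∫ y in Ioi (0:ℝ), g y) * fundSol α t x with hF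
  have hFeq : ∀ x, F x = c * ∫ y in Ioi (0:ℝ), k x y * g y := by
    intro x
    have i1 : IntegrableOn (fun y => (fundSol α t (x - y) + fundSol α t (x + y)) * g y) (Ioi 0) := by
      refine Integrable.bdd_mul (c := |c| * 2) hg ?_ ?_
      · apply Continuous.aestronglyMeasurable
        have : Continuous fun y => c * Ψ (x - y) + c * Ψ (x + y) := by fun_prop
        exact this
      · refine Eventually.of_forall fun y => ?_
        have e : fundSol α t (x - y) + fundSol α t (x + y) = c * (Ψ (x - y) + Ψ (x + y)) := by
          rw [mul_add]; rfl
        rw [e, norm_mul, Real.norm_eq_abs, Real.norm_of_nonneg (add_nonneg (hn _) (hn _))]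
        gcongr
        linarith [hle (x - y), hle (x + y)]
    have i2 : IntegrableOn (fun y => 2 * fundSol α t x * g y) (Ioi 0) := hg.const_mul _
    have e1 : 2 * (∫ y in Ioi (0:ℝ), g y) * fundSol α t x = ∫ y in Ioi (0:ℝ), 2 * fundSol α t x * g y := by
      rw [integral_const_mul]; ring
    simp only [hF]
    rw [e1, ← integral_sub i1 i2, ← integral_const_mul]
    congr 1; ext y
    have e : ∀ z, fundSol α t z = c * Ψ z := fun z => rfl
    simp only [e, hk]
    ring
  have hFle : ∀ x, ‖F x‖ₑ ≤ ‖c‖ₑ * ∫⁻ y in Ioi (0:ℝ), ‖k x y‖ₑ * ‖g y‖ₑ := by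
    intro x
    rw [hFeq, enorm_mul]
    gcongr
    refine (enorm_integral_le_lintegral_enorm _).trans ?_
    simp_rw [enorm_mul]
    exact le_rfl
  have hkc : Continuous (Function.uncurry k) := by
    simp only [hk, Function.uncurry_def]
    fun_prop
  have hsup : ∀ x, ‖F x‖ₑ ≤ ENNReal.ofReal (|c| * (2 * L * τ) * m) := by
    intro x
    refine (hFle x).trans ?_
    have hkx : ∀ y, ‖k x y‖ₑ ≤ ENNReal.ofReal (2 * L * τ) * ‖y‖ₑ := by
      intro y
      rw [← ofReal_norm, ← ofReal_norm, ← ENNReal.ofReal_mul (by positivity)]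
      apply ENNReal.ofReal_le_ofReal
      have b1 := hL' (x - y) x
      have b2 := hL' (x + y) x
      rw [show x - y - x = -y by ring, abs_neg] at b1
      rw [show x + y - x = y by ring] at b2
      have e : k x y = (Ψ (x - y) - Ψ x) + (Ψ (x + y) - Ψ x) := by simp only [hk]; ring
      rw [e, Real.norm_eq_abs, Real.norm_eq_abs]
      refine (abs_add_le _ _).trans ?_
      linarith
    calc ‖c‖ₑ * ∫⁻ y in Ioi (0:ℝ), ‖k x y‖ₑ * ‖g y‖ₑ
        ≤ ‖c‖ₑ * ∫⁻ y in Ioi (0:ℝ), ENNReal.ofReal (2 * L * τ) * ‖y * g y‖ₑ := by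
          refine mul_le_mul_right (lintegral_mono fun y => ?_) _
          rw [enorm_mul, ← mul_assoc]
          exact mul_le_mul_left (hkx y) _
      _ = _ := by
          rw [lintegral_const_mul' _ _ ENNReal.ofReal_ne_top, hM, ← ofReal_norm, Real.norm_eq_abs,
            ← ENNReal.ofReal_mul (by positivity), ← ENNReal.ofReal_mul (by positivity), ← mul_assoc]
  have hL1 : ∫⁻ x in Ioi (0:ℝ), ‖F x‖ₑ ≤ ENNReal.ofReal (|c| * 3 * m) := by
    have hky : ∀ y, 0 < y → ∫⁻ x in Ioi (0:ℝ), ‖k x y‖ₑ ≤ 3 * ‖y‖ₑ := by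
      intro y hy
      have hm1 : Measurable fun x => ‖Ψ (x - y) - Ψ x‖ₑ := by
        have : Continuous fun x => Ψ (x - y) - Ψ x := by fun_prop
        exact this.measurable.enorm
      calc ∫⁻ x in Ioi (0:ℝ), ‖k x y‖ₑ ≤ ∫⁻ x in Ioi (0:ℝ), (‖Ψ (x - y) - Ψ x‖ₑ + ‖Ψ (x + y) - Ψ x‖ₑ) := by
            gcongr with x
            have e : k x y = (Ψ (x - y) - Ψ x) + (Ψ (x + y) - Ψ x) := by simp only [hk]; ring
            rw [e]
            exact enorm_add_le _ _
        _ = (∫⁻ x in Ioi (0:ℝ), ‖Ψ (x - y) - Ψ x‖ₑ) + ∫⁻ x in Ioi (0:ℝ), ‖Ψ (x + y) - Ψ x‖ₑ :=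
            lintegral_add_left hm1 _
        _ ≤ 2 * ENNReal.ofReal y + ENNReal.ofReal y :=
            add_le_add (shift_left hc hn hle ha hy) (shift_right hc hn hle ha hy)
        _ = 3 * ‖y‖ₑ := by
            rw [← ofReal_norm, Real.norm_of_nonneg hy.le]; ring
    have hmeas : AEMeasurable (Function.uncurry fun x y => ‖k x y‖ₑ * ‖g y‖ₑ)
        ((volume.restrict (Ioi (0:ℝ))).prod (volume.restrict (Ioi (0:ℝ)))) := by
      refine AEMeasurable.mul (hkc.measurable.enorm.aemeasurable) ?_
      exact (hg.aestronglyMeasurable.comp_snd).enorm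
    calc ∫⁻ x in Ioi (0:ℝ), ‖F x‖ₑ
        ≤ ∫⁻ x in Ioi (0:ℝ), ‖c‖ₑ * ∫⁻ y in Ioi (0:ℝ), ‖k x y‖ₑ * ‖g y‖ₑ := by
          gcongr with x; exact hFle x
      _ = ‖c‖ₑ * ∫⁻ x in Ioi (0:ℝ), ∫⁻ y in Ioi (0:ℝ), ‖k x y‖ₑ * ‖g y‖ₑ :=
          lintegral_const_mul' _ _ enorm_ne_top
      _ = ‖c‖ₑ * ∫⁻ y in Ioi (0:ℝ), ∫⁻ x in Ioi (0:ℝ), ‖k x y‖ₑ * ‖g y‖ₑ := by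
          rw [lintegral_lintegral_swap hmeas]
      _ ≤ ‖c‖ₑ * ∫⁻ y in Ioi (0:ℝ), 3 * ‖y * g y‖ₑ := by
          gcongr 1
          refine setLIntegral_mono' measurableSet_Ioi fun y hy => ?_
          rw [lintegral_mul_const' _ _ enorm_ne_top, enorm_mul, ← mul_assoc]
          gcongr
          exact hky y hy
      _ = _ := by
          rw [lintegral_const_mul' _ _ (by simp), hM, ← ofReal_norm, Real.norm_eq_abs,
            show (3 : ENNReal) = ENNReal.ofReal 3 by simp,
            ← ENNReal.ofReal_mul (by positivity), ← ENNReal.ofReal_mul (by positivity), ← mul_assoc]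
  refine (interp hθ ENNReal.ofReal_ne_top (Eventually.of_forall hsup) hL1).trans ?_
  have hθ0 := hθ.1
  have hθ1 : 0 < 1 - θ := by linarith [hθ.2]
  rw [ENNReal.ofReal_rpow_of_nonneg (by positivity) hθ0.le,
    ENNReal.ofReal_rpow_of_nonneg (by positivity) hθ1.le, ← ENNReal.ofReal_mul (by positivity)]
  apply ENNReal.ofReal_le_ofReal
  have hq : 0 ≤ |c| * m := by positivity
  have e1 : |c| * (2 * L * τ) * m = (|c| * m) * ((2 * L) * τ) := by ring
  have e2 : |c| * 3 * m = (|c| * m) * 3 := by ring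
  have e3 : (|c| * m) ^ θ * (|c| * m) ^ (1 - θ) = |c| * m := by
    rw [← rpow_add_of_nonneg hq hθ0.le hθ1.le, add_sub_cancel, rpow_one]
  have e4 : τ * τ ^ θ = t ^ (-(1+θ)/(1+α)) := by
    rw [← rpow_one_add' hτ.le (by positivity), hτdef, ← rpow_mul ht0.le]
    congr 1; ring
  rw [e1, e2, mul_rpow hq (by positivity), mul_rpow hq (by positivity), mul_rpow (by positivity) hτ.le]
  calc _ = ((|c| * m) ^ θ * (|c| * m) ^ (1 - θ)) * (((2 * L) ^ θ * 3 ^ (1 - θ)) * τ ^ θ) := by ring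
    _ = |a0 α| * ((2 * L) ^ θ * 3 ^ (1 - θ)) * (τ * τ ^ θ) * m := by
      rw [e3, hcdef, abs_mul, abs_of_pos hτ]; ring
    _ ≤ _ := by
      rw [e4]
      gcongr
      linarith
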